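/- arXiv:2112.00191 — 9 statements merged into one kernel-verified Lean document; each statement's English description precedes it below -/
import Mathlib

section
/- (Arc-chord bound) Let γ ∈ (0,1] and M ≥ M' > 0. Let z : ℝ → ℝ² be continuously differentiable with |z'(ξ) − z'(η)| ≤ M|ξ−η|^γ for all ξ, η, and |z'(ξ)| ≥ M' for all ξ. Set δ := (M'/(4M))^{1/γ}. Then for all ξ, η with |ξ − η| ≤ δ, one has |z(ξ) − z(η)| ≥ (M'/2) |ξ − η|. -/
open Real Set

noncomputable section

abbrev R2 : Type := EuclideanSpace ℝ (Fin 2)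

/-- (Arc-chord bound) Let `γ ∈ (0,1]` and `M ≥ M' > 0`. If `z : ℝ → ℝ²` is continuously
differentiable with `|z'(ξ)−z'(η)| ≤ M|ξ−η|^γ` and `|z'(ξ)| ≥ M'` for all `ξ, η`, and
`δ := (M'/(4M))^{1/γ}`, then `|z(ξ)−z(η)| ≥ (M'/2)|ξ−η|` whenever `|ξ−η| ≤ δ`. -/
theorem arc_chord_bound (γ M M' : ℝ) (z : ℝ → R2)
    (hγ0 : 0 < γ) (hγ1 : γ ≤ 1) (hM' : 0 < M') (hMM : M' ≤ M)
    (hz : ContDiff ℝ 1 z)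
    (hHolder : ∀ ξ η : ℝ, ‖deriv z ξ - deriv z η‖ ≤ M * |ξ - η| ^ γ)
    (hlow : ∀ ξ : ℝ, M' ≤ ‖deriv z ξ‖) :
    ∀ ξ η : ℝ, |ξ - η| ≤ (M' / (4 * M)) ^ (1 / γ) →
      M' / 2 * |ξ - η| ≤ ‖z ξ - z η‖ := by
  intro ξ η h
  have hM : 0 < M := lt_of_lt_of_le hM' hMM
  have hd : Differentiable ℝ z := hz.differentiable (by norm_num)
  have hpow : |ξ - η| ^ γ ≤ M' / (4 * M) := by
    calc |ξ - η| ^ γ ≤ ((M' / (4 * M)) ^ (1 / γ)) ^ γ :=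
          Real.rpow_le_rpow (abs_nonneg _) h hγ0.le
      _ = M' / (4 * M) := by
          rw [← Real.rpow_mul (by positivity), one_div_mul_cancel hγ0.ne', Real.rpow_one]
  have key := Convex.norm_image_sub_le_of_norm_hasDerivWithin_le
    (f := fun x => z x - x • deriv z η) (f' := fun x => deriv z x - deriv z η)
    (s := Set.uIcc η ξ) (C := M' / 4) (x := η) (y := ξ)
    (fun x _ => by
      have h2 := (hd x).hasDerivAt.sub ((hasDerivAt_id x).smul_const (deriv z η))
      simp only [one_smul] at h2
      exact h2.hasDerivWithinAt)
    (fun x hx => by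
      refine (hHolder x η).trans ?_
      have h1 : |x - η| ≤ |ξ - η| := Set.abs_sub_left_of_mem_uIcc hx
      have h2 := Real.rpow_le_rpow (abs_nonneg _) h1 hγ0.le
      calc M * |x - η| ^ γ ≤ M * (M' / (4 * M)) := by gcongr; exact h2.trans hpow
        _ = M' / 4 := by field_simp)
    (convex_uIcc _ _) Set.left_mem_uIcc Set.right_mem_uIcc
  have e : (z ξ - ξ • deriv z η) - (z η - η • deriv z η)
      = (z ξ - z η) - (ξ - η) • deriv z η := by
    rw [sub_smul]; abel
  simp only [e, Real.norm_eq_abs] at key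
  have h3 := norm_sub_norm_le ((ξ - η) • deriv z η) (z ξ - z η)
  rw [norm_sub_rev _ (z ξ - z η), norm_smul, Real.norm_eq_abs] at h3
  have h4 := mul_le_mul_of_nonneg_left (hlow η) (abs_nonneg (ξ - η))
  have h5 := mul_nonneg hM'.le (abs_nonneg (ξ - η))
  linarith
end
end

section
/- (Lemma 2.4, case γ > 2α) Let α ∈ (0, 1/2), γ ∈ (2α, 1], and A, R > 0. Then there is a constant C, depending only on α, γ, A, R, with the following property. Let f : [−R, R] → ℝ and s ∈ ℝ satisfy |f(h) − f(0) − s h| ≤ A|h|^{1+γ} for all h ∈ [−R,R]. Then for every m ∈ (0, R/2], the iterated integral J₂ := ∫_{−R}^{R} ∫_{f(0)+sh}^{f(h)} [ h/(h²+v²)^{1+α} − h/(h²+(v−m)²)^{1+α} ] dv dh satisfies |J₂| ≤ C m. -/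
open Real MeasureTheory Set

noncomputable section

/-- The g-SQG patch kernel `K_m(h,v) = h/(h²+v²)^{1+α} − h/(h²+(v−m)²)^{1+α}`. -/
def Km (α m h v : ℝ) : ℝ :=
  h / (h ^ 2 + v ^ 2) ^ (1 + α) - h / (h ^ 2 + (v - m) ^ 2) ^ (1 + α)

lemma Km_aux (α m h v : ℝ) (hα0 : 0 < α) (hm : 0 < m) (hh : h ≠ 0) :
    ‖Km α m h v‖ ≤ (1 + α) * (h ^ 2) ^ (-(1 + α)) * m := by
  have hpos : ∀ w : ℝ, 0 < h ^ 2 + w ^ 2 := fun w => by positivity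
  have hd : ∀ w ∈ (univ : Set ℝ), HasDerivWithinAt (fun w : ℝ => h * (h ^ 2 + w ^ 2) ^ (-(1 + α)))
      (h * ((2 * w) * (-(1 + α)) * (h ^ 2 + w ^ 2) ^ (-(1 + α) - 1))) univ w := by
    intro w _
    have h1 : HasDerivAt (fun w : ℝ => h ^ 2 + w ^ 2) (2 * w) w := by
      simpa using (hasDerivAt_pow 2 w).const_add (h ^ 2)
    exact ((h1.rpow_const (Or.inl (hpos w).ne')).const_mul h).hasDerivWithinAt
  have hb : ∀ w ∈ (univ : Set ℝ),
      ‖h * ((2 * w) * (-(1 + α)) * (h ^ 2 + w ^ 2) ^ (-(1 + α) - 1))‖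
        ≤ (1 + α) * (h ^ 2) ^ (-(1 + α)) := by
    intro w _
    have hP := hpos w
    have hh2 : 0 < h ^ 2 := by positivity
    have e1 : ‖h * ((2 * w) * (-(1 + α)) * (h ^ 2 + w ^ 2) ^ (-(1 + α) - 1))‖
        = (1 + α) * ((2 * |h| * |w|) * (h ^ 2 + w ^ 2) ^ (-(1 + α) - 1)) := by
      rw [Real.norm_eq_abs, abs_mul, abs_mul, abs_mul, abs_mul, abs_neg,
        abs_of_pos (by linarith : (0:ℝ) < 1 + α), abs_of_pos (rpow_pos_of_pos hP _)]
      norm_num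
      ring
    rw [e1]
    apply mul_le_mul_of_nonneg_left _ (by linarith)
    calc (2 * |h| * |w|) * (h ^ 2 + w ^ 2) ^ (-(1 + α) - 1)
        ≤ (h ^ 2 + w ^ 2) * (h ^ 2 + w ^ 2) ^ (-(1 + α) - 1) := by
          apply mul_le_mul_of_nonneg_right _ (rpow_nonneg hP.le _)
          nlinarith [sq_nonneg (|h| - |w|), sq_abs h, sq_abs w]
      _ = (h ^ 2 + w ^ 2) ^ (-(1 + α)) := by
          rw [rpow_sub_one hP.ne']
          field_simp
      _ ≤ (h ^ 2) ^ (-(1 + α)) :=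
          rpow_le_rpow_of_nonpos hh2 (by nlinarith [sq_nonneg w]) (by linarith)
  have key := (convex_univ).norm_image_sub_le_of_norm_hasDerivWithin_le hd hb
    (mem_univ (v - m)) (mem_univ v)
  have e2 : v - (v - m) = m := by ring
  rw [e2, Real.norm_of_nonneg hm.le] at key
  have e3 : Km α m h v = h * (h ^ 2 + v ^ 2) ^ (-(1 + α))
      - h * (h ^ 2 + (v - m) ^ 2) ^ (-(1 + α)) := by
    rw [Km, rpow_neg (hpos v).le, rpow_neg (hpos (v - m)).le, div_eq_mul_inv, div_eq_mul_inv]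
  rw [e3]
  exact key

lemma abs_rpow_ii (p R : ℝ) (hp : -1 < p) (hR : 0 < R) :
    IntervalIntegrable (fun h : ℝ => |h| ^ p) volume (-R) R := by
  have h1 : IntervalIntegrable (fun h : ℝ => |h| ^ p) volume 0 R := by
    refine (intervalIntegral.intervalIntegrable_rpow' hp (a := 0) (b := R)).congr ?_
    intro x hx
    rw [uIoc_of_le hR.le] at hx
    simp only [abs_of_pos hx.1]
  have h2 : IntervalIntegrable (fun h : ℝ => |h| ^ p) volume (-R) 0 := by
    have := (IntervalIntegrable.iff_comp_neg (f := fun h : ℝ => |h| ^ p) (a := 0) (b := R)).mp h1 |>.symm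
    simpa using this
  exact h2.trans h1

/-- (Lemma 2.4, case `γ > 2α`) Let `α ∈ (0,1/2)`, `γ ∈ (2α,1]`, `A, R > 0`. There is a
constant `C = C(α,γ,A,R)` such that for every `f : [−R,R] → ℝ` and `s ∈ ℝ` with
`|f(h) − f(0) − sh| ≤ A|h|^{1+γ}` on `[−R,R]`, and every `m ∈ (0,R/2]`, the iterated integral
`J₂ = ∫_{−R}^{R} ∫_{f(0)+sh}^{f(h)} K_m(h,v) dv dh` satisfies `|J₂| ≤ Cm`. -/
theorem J2_estimate_gamma_gt (α γ A R : ℝ) (hα0 : 0 < α) (hα : α < 1 / 2)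
    (hγ1 : 2 * α < γ) (hγ2 : γ ≤ 1) (hA : 0 < A) (hR : 0 < R) :
    ∃ C : ℝ, ∀ (f : ℝ → ℝ) (s : ℝ),
      (∀ h ∈ Icc (-R) R, |f h - f 0 - s * h| ≤ A * |h| ^ (1 + γ)) →
      ∀ m : ℝ, 0 < m → m ≤ R / 2 →
        |∫ h in (-R)..R, ∫ v in (f 0 + s * h)..(f h), Km α m h v| ≤ C * m := by
  refine ⟨∫ h in (-R)..R, ((1 + α) * A) * |h| ^ (γ - 1 - 2 * α), ?_⟩
  intro f s hf m hm _
  rw [← intervalIntegral.integral_mul_const, ← Real.norm_eq_abs]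
  refine intervalIntegral.norm_integral_le_of_norm_le (by linarith) ?_
    (((abs_rpow_ii _ R (by linarith) hR).const_mul _).mul_const _)
  refine Filter.Eventually.of_forall fun h hh => ?_
  by_cases h0 : h = 0
  · subst h0
    simp only [Km, zero_div, sub_zero, intervalIntegral.integral_zero, norm_zero]
    positivity
  · have hab : 0 < |h| := abs_pos.mpr h0
    have h1 := intervalIntegral.norm_integral_le_of_norm_le_const
      (a := f 0 + s * h) (b := f h) (fun v _ => Km_aux α m h v hα0 hm h0)
    have h2 := hf h ⟨hh.1.le, hh.2⟩
    refine h1.trans ?_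
    rw [← sub_sub]
    have e : (h ^ 2) ^ (-(1 + α)) * |h| ^ (1 + γ) = |h| ^ (γ - 1 - 2 * α) := by
      rw [← sq_abs, ← rpow_natCast, ← rpow_mul hab.le, ← rpow_add hab]
      congr 1
      push_cast
      ring
    calc (1 + α) * (h ^ 2) ^ (-(1 + α)) * m * |f h - f 0 - s * h|
        ≤ (1 + α) * (h ^ 2) ^ (-(1 + α)) * m * (A * |h| ^ (1 + γ)) :=
          mul_le_mul_of_nonneg_left h2 (by positivity)
      _ = (1 + α) * A * ((h ^ 2) ^ (-(1 + α)) * |h| ^ (1 + γ)) * m := by ring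
      _ = _ := by rw [e]

end
end

section
/- (Lemma 2.4, case γ = 2α) Let α ∈ (0, 1/2), γ = 2α, and A, R > 0. Then there is a constant C, depending only on α, A, R, with the following property. Let f : [−R, R] → ℝ and s ∈ ℝ satisfy |f(h) − f(0) − s h| ≤ A|h|^{1+γ} for all h ∈ [−R,R]. Then for every m ∈ (0, R/2], the iterated integral J₂ := ∫_{−R}^{R} ∫_{f(0)+sh}^{f(h)} [ h/(h²+v²)^{1+α} − h/(h²+(v−m)²)^{1+α} ] dv dh satisfies |J₂| ≤ C m (1 + max(0, −ln m)). -/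
open Real MeasureTheory Set

noncomputable section

lemma phi_bound (α h : ℝ) (hα0 : 0 < α) (hα : α < 1 / 2) (hh : h ≠ 0) (v : ℝ) :
    |h / (h ^ 2 + v ^ 2) ^ (1 + α)| ≤ |h| * (h ^ 2) ^ (-(1 + α)) := by
  have h2 : 0 < h ^ 2 := by positivity
  have hv : 0 ≤ v ^ 2 := sq_nonneg v
  have hp : 0 < h ^ 2 + v ^ 2 := by positivity
  rw [div_eq_mul_inv, ← Real.rpow_neg hp.le, abs_mul, abs_of_nonneg (Real.rpow_nonneg hp.le _)]
  exact mul_le_mul_of_nonneg_left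
    (Real.rpow_le_rpow_of_nonpos h2 (by linarith) (by linarith)) (abs_nonneg h)

lemma phi_lip (α h : ℝ) (hα0 : 0 < α) (hα : α < 1 / 2) (hh : h ≠ 0) (v w : ℝ) :
    |h / (h ^ 2 + v ^ 2) ^ (1 + α) - h / (h ^ 2 + w ^ 2) ^ (1 + α)| ≤
      2 * (h ^ 2) ^ (-(1 + α)) * |v - w| := by
  have h2 : 0 < h ^ 2 := by positivity
  have key : ∀ x ∈ (univ : Set ℝ), HasDerivWithinAt (fun v : ℝ => h / (h ^ 2 + v ^ 2) ^ (1 + α))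
      (h * ((2 * x) * (-(1 + α)) * (h ^ 2 + x ^ 2) ^ (-(1 + α) - 1))) univ x := by
    intro x _
    have hp : 0 < h ^ 2 + x ^ 2 := by positivity
    have h1 : HasDerivAt (fun v : ℝ => h ^ 2 + v ^ 2) (2 * x) x := by
      simpa using (hasDerivAt_pow 2 x).const_add (h ^ 2)
    have h3 := (h1.rpow_const (p := -(1 + α)) (Or.inl hp.ne')).const_mul h
    have e : (fun v : ℝ => h / (h ^ 2 + v ^ 2) ^ (1 + α)) =
        fun v : ℝ => h * (h ^ 2 + v ^ 2) ^ (-(1 + α)) := by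
      funext v
      rw [div_eq_mul_inv, ← Real.rpow_neg (by positivity)]
    rw [e]
    exact h3.hasDerivWithinAt
  have bd : ∀ x ∈ (univ : Set ℝ),
      ‖h * ((2 * x) * (-(1 + α)) * (h ^ 2 + x ^ 2) ^ (-(1 + α) - 1))‖ ≤
        2 * (h ^ 2) ^ (-(1 + α)) := by
    intro x _
    have hx : 0 ≤ x ^ 2 := sq_nonneg x
    have hp : 0 < h ^ 2 + x ^ 2 := by positivity
    have hmono : (h ^ 2 + x ^ 2) ^ (-(1 + α)) ≤ (h ^ 2) ^ (-(1 + α)) :=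
      Real.rpow_le_rpow_of_nonpos h2 (by linarith) (by linarith)
    have hq : 0 ≤ (h ^ 2 + x ^ 2) ^ (-(1 + α)) := Real.rpow_nonneg hp.le _
    rw [Real.rpow_sub_one hp.ne', Real.norm_eq_abs]
    have e : h * ((2 * x) * (-(1 + α)) * ((h ^ 2 + x ^ 2) ^ (-(1 + α)) / (h ^ 2 + x ^ 2))) =
      (-(1 + α)) * (2 * (h * x) / (h ^ 2 + x ^ 2)) * (h ^ 2 + x ^ 2) ^ (-(1 + α)) := by
      field_simp
    have h4 : |2 * (h * x) / (h ^ 2 + x ^ 2)| ≤ 1 := by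
      rw [abs_div, abs_of_pos hp, div_le_one hp, abs_le]
      constructor <;> nlinarith [sq_nonneg (h - x), sq_nonneg (h + x)]
    rw [e, abs_mul, abs_mul, abs_of_nonneg hq, abs_neg, abs_of_pos (by linarith : 0 < 1 + α)]
    have h5 : (1 + α) * |2 * (h * x) / (h ^ 2 + x ^ 2)| ≤ 2 := by
      nlinarith [abs_nonneg (2 * (h * x) / (h ^ 2 + x ^ 2))]
    exact mul_le_mul h5 hmono hq (by norm_num)
  have := convex_univ.norm_image_sub_le_of_norm_hasDerivWithin_le key bd (mem_univ w) (mem_univ v)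
  simpa [Real.norm_eq_abs] using this

lemma Km_bound (α m h : ℝ) (hα0 : 0 < α) (hα : α < 1 / 2) (hm : 0 < m) (hh : h ≠ 0) (v : ℝ) :
    |Km α m h v| ≤ 4 * m / (m + |h|) * (|h| * (h ^ 2) ^ (-(1 + α))) := by
  have hpos : 0 < |h| := abs_pos.mpr hh
  have hs : 0 < m + |h| := by positivity
  have h1 := phi_lip α h hα0 hα hh v (v - m)
  have e : |v - (v - m)| = m := by rw [sub_sub_cancel, abs_of_pos hm]
  rw [e] at h1
  have h2 := phi_bound α h hα0 hα hh v
  have h3 := phi_bound α h hα0 hα hh (v - m)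
  have h4 := abs_sub (h / (h ^ 2 + v ^ 2) ^ (1 + α)) (h / (h ^ 2 + (v - m) ^ 2) ^ (1 + α))
  unfold Km
  set K := |h / (h ^ 2 + v ^ 2) ^ (1 + α) - h / (h ^ 2 + (v - m) ^ 2) ^ (1 + α)|
  set P := (h ^ 2) ^ (-(1 + α))
  have h5 : K ≤ 2 * (|h| * P) := by linarith
  rw [div_mul_eq_mul_div, le_div_iff₀ hs]
  nlinarith [mul_le_mul_of_nonneg_left h5 hm.le, mul_le_mul_of_nonneg_left h1 hpos.le]

lemma inner_bound (α m h A a b : ℝ) (hα0 : 0 < α) (hα : α < 1 / 2) (hm : 0 < m)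
    (hA : 0 < A) (hab : |b - a| ≤ A * |h| ^ (1 + 2 * α)) :
    ‖∫ v in a..b, Km α m h v‖ ≤ 4 * A * m * (m + |h|)⁻¹ := by
  by_cases hh : h = 0
  · subst hh
    simp [Km]
    positivity
  have hpos : 0 < |h| := abs_pos.mpr hh
  have h1 := intervalIntegral.norm_integral_le_of_norm_le_const (a := a) (b := b)
    (f := fun v => Km α m h v)
    (C := 4 * m / (m + |h|) * (|h| * (h ^ 2) ^ (-(1 + α))))
    (fun v _ => Km_bound α m h hα0 hα hm hh v)
  refine h1.trans ?_
  have hP : 0 ≤ 4 * m / (m + |h|) * (|h| * (h ^ 2) ^ (-(1 + α))) := by positivity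
  refine (mul_le_mul_of_nonneg_left hab hP).trans (le_of_eq ?_)
  have e : |h| * (h ^ 2) ^ (-(1 + α)) * |h| ^ (1 + 2 * α) = 1 := by
    rw [← sq_abs, ← Real.rpow_natCast, ← Real.rpow_mul hpos.le]
    nth_rewrite 1 [← Real.rpow_one |h|]
    rw [← Real.rpow_add hpos, ← Real.rpow_add hpos]
    convert Real.rpow_zero _ using 2
    push_cast
    ring
  calc _ = 4 * A * m * (m + |h|)⁻¹ * (|h| * (h ^ 2) ^ (-(1 + α)) * |h| ^ (1 + 2 * α)) := by
        rw [div_eq_mul_inv]; ring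
    _ = _ := by rw [e, mul_one]

lemma cont_g (m : ℝ) (hm : 0 < m) : Continuous fun h : ℝ => (m + |h|)⁻¹ :=
  (continuous_const.add continuous_abs).inv₀ (fun x => (add_pos_of_pos_of_nonneg hm (abs_nonneg x)).ne')

lemma int_g (m R : ℝ) (hm : 0 < m) (hR : 0 < R) :
    ∫ h in (-R)..R, (m + |h|)⁻¹ = 2 * (Real.log (m + R) - Real.log m) := by
  have ii : ∀ a b : ℝ, IntervalIntegrable (fun h : ℝ => (m + |h|)⁻¹) volume a b :=
    fun a b => (cont_g m hm).intervalIntegrable a b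
  have h1 : ∫ h in (0:ℝ)..R, (m + |h|)⁻¹ = Real.log (m + R) - Real.log m := by
    have : ∫ h in (0:ℝ)..R, (m + |h|)⁻¹ = ∫ h in (0:ℝ)..R, (m + h)⁻¹ := by
      apply intervalIntegral.integral_congr
      intro x hx
      rw [uIcc_of_le hR.le] at hx
      simp only [abs_of_nonneg hx.1]
    rw [this, intervalIntegral.integral_comp_add_left (fun x : ℝ => x⁻¹) m, add_zero,
      integral_inv_of_pos hm (by positivity), Real.log_div (by positivity) hm.ne']
  have h2 : ∫ h in (-R)..0, (m + |h|)⁻¹ = ∫ h in (0:ℝ)..R, (m + |h|)⁻¹ := by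
    have := intervalIntegral.integral_comp_neg (a := 0) (b := R) (fun h : ℝ => (m + |h|)⁻¹)
    simp only [abs_neg, neg_zero] at this
    exact this.symm
  rw [← intervalIntegral.integral_add_adjacent_intervals (ii (-R) 0) (ii 0 R), h2, h1]
  ring

/-- (Lemma 2.4, case `γ = 2α`) Let `α ∈ (0,1/2)`, `γ = 2α`, `A, R > 0`. There is a constant
`C = C(α,A,R)` such that for every `f : [−R,R] → ℝ` and `s ∈ ℝ` with
`|f(h) − f(0) − sh| ≤ A|h|^{1+γ}` on `[−R,R]`, and every `m ∈ (0,R/2]`, the iterated integral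
`J₂ = ∫_{−R}^{R} ∫_{f(0)+sh}^{f(h)} K_m(h,v) dv dh` satisfies
`|J₂| ≤ C m (1 + max(0, −ln m))`. -/
theorem J2_estimate_gamma_eq (α γ A R : ℝ) (hα0 : 0 < α) (hα : α < 1 / 2)
    (hγ : γ = 2 * α) (hA : 0 < A) (hR : 0 < R) :
    ∃ C : ℝ, ∀ (f : ℝ → ℝ) (s : ℝ),
      (∀ h ∈ Icc (-R) R, |f h - f 0 - s * h| ≤ A * |h| ^ (1 + γ)) →
      ∀ m : ℝ, 0 < m → m ≤ R / 2 →
        |∫ h in (-R)..R, ∫ v in (f 0 + s * h)..(f h), Km α m h v| ≤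
          C * m * (1 + max 0 (-Real.log m)) := by
  refine ⟨8 * A * (1 + |Real.log (2 * R)|), ?_⟩
  intro f s hf m hm hmR
  subst hγ
  have hle : -R ≤ R := by linarith
  have h1 := intervalIntegral.norm_integral_le_of_norm_le (μ := volume) hle
    (f := fun h => ∫ v in (f 0 + s * h)..(f h), Km α m h v)
    (g := fun h => 4 * A * m * (m + |h|)⁻¹)
    (Filter.Eventually.of_forall fun h hh => by
      apply inner_bound α m h A _ _ hα0 hα hm hA
      have := hf h ⟨hh.1.le, hh.2⟩
      rwa [sub_sub] at this)
    ((continuous_const.mul (cont_g m hm)).intervalIntegrable _ _)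
  rw [intervalIntegral.integral_const_mul, int_g m R hm hR, Real.norm_eq_abs] at h1
  refine h1.trans ?_
  have h2 : Real.log (m + R) ≤ Real.log (2 * R) :=
    Real.log_le_log (by positivity) (by linarith)
  have h3 := le_abs_self (Real.log (2 * R))
  have h4 := le_max_right 0 (-Real.log m)
  have h5 := le_max_left 0 (-Real.log m)
  have h6 := abs_nonneg (Real.log (2 * R))
  set M := max 0 (-Real.log m)
  set L := |Real.log (2 * R)|
  have h7 : Real.log (m + R) - Real.log m ≤ (1 + L) * (1 + M) := by
    nlinarith [mul_nonneg h6 h5]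
  have h8 : 0 ≤ 8 * A * m := by positivity
  nlinarith [mul_le_mul_of_nonneg_left h7 h8]

end
end

section
/- (Lemma 2.5) Let α ∈ (0, 1/2), γ ∈ (0,1], B ≥ 0, R > 0, a > 0, and m > 0. Let s ∈ ℝ satisfy |s| ≤ B a^{γ/(1+γ)} and |s| ≤ 1/2. Then the iterated integral J₁ := ∫_{−R}^{R} ∫_{0}^{sh} [ h/(h²+(v−a)²)^{1+α} − h/(h²+(v−a−m)²)^{1+α} ] dv dh satisfies |J₁| ≤ (12/(1−2α) + 3/α) · B a^{γ/(1+γ)} · m / (a+m)^{2α}. -/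
open Real MeasureTheory Set

noncomputable section

/-- The shifted g-SQG patch kernel
`K̃(h,v) = h/(h²+(v−a)²)^{1+α} − h/(h²+(v−a−m)²)^{1+α}`. -/
def Kt (α a m h v : ℝ) : ℝ :=
  h / (h ^ 2 + (v - a) ^ 2) ^ (1 + α) - h / (h ^ 2 + (v - a - m) ^ 2) ^ (1 + α)

lemma aux_Kt (α a m h v d : ℝ) (hα0 : 0 < α) (hα : α < 1 / 2) (hm : 0 < m) (hh : h ≠ 0)
    (hd : 0 < d) (hX : ∀ b ∈ Set.Icc a (a + m), d ^ 2 ≤ h ^ 2 + (v - b) ^ 2) :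
    |Kt α a m h v| ≤ 3 * m / d * (|h| * (h ^ 2) ^ (-(1 + α))) := by
  have hh2 : 0 < h ^ 2 := by positivity
  have key := (convex_Icc a (a + m)).norm_image_sub_le_of_norm_hasDerivWithin_le
    (f := fun b : ℝ => (h ^ 2 + (v - b) ^ 2) ^ (-(1 + α)))
    (f' := fun b : ℝ => (2 * (v - b) * (-1)) * (-(1 + α)) *
      (h ^ 2 + (v - b) ^ 2) ^ (-(1 + α) - 1))
    (C := 3 / d * (h ^ 2) ^ (-(1 + α))) (x := a + m) (y := a) ?_ ?_ ?_ ?_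
  · have e : Kt α a m h v = h * ((h ^ 2 + (v - a) ^ 2) ^ (-(1 + α))
        - (h ^ 2 + (v - (a + m)) ^ 2) ^ (-(1 + α))) := by
      unfold Kt
      rw [Real.rpow_neg (by positivity), Real.rpow_neg (by positivity), ← sub_sub]
      ring
    rw [e, abs_mul]
    simp only [Real.norm_eq_abs] at key
    have e2 : |a - (a + m)| = m := by
      rw [show a - (a + m) = -m by ring, abs_neg, abs_of_pos hm]
    rw [e2] at key
    calc _ ≤ |h| * (3 / d * (h ^ 2) ^ (-(1 + α)) * m) := by gcongr
      _ = _ := by ring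
  · intro b _
    have h1 : HasDerivAt (fun b : ℝ => h ^ 2 + (v - b) ^ 2) (2 * (v - b) * (-1)) b := by
      have := (((hasDerivAt_id b).const_sub v).pow 2).const_add (h ^ 2)
      simpa using this
    exact (h1.rpow_const (Or.inl (by positivity))).hasDerivWithinAt
  · intro b hb
    have hXb := hX b hb
    set X := h ^ 2 + (v - b) ^ 2 with hXdef
    have hXp : 0 < X := by positivity
    have h1 : |v - b| * d ≤ X := by
      apply abs_le_of_sq_le_sq' _ hXp.le |>.2
      rw [mul_pow, sq_abs, sq X]
      apply mul_le_mul _ hXb (by positivity) hXp.le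
      rw [hXdef]; nlinarith
    have h2 : X ^ (-(1 + α)) ≤ (h ^ 2) ^ (-(1 + α)) := by
      apply Real.rpow_le_rpow_of_nonpos hh2 _ (by linarith)
      rw [hXdef]; nlinarith [sq_nonneg (v - b)]
    rw [Real.rpow_sub_one hXp.ne', Real.norm_eq_abs, abs_mul, abs_mul, abs_mul, abs_mul,
      abs_neg, abs_neg, abs_one, abs_two, abs_of_pos (show 0 < 1 + α by linarith),
      abs_of_nonneg (show 0 ≤ X ^ (-(1 + α)) / X by positivity)]
    have h3 : |v - b| / X ≤ 1 / d := by
      rw [div_le_div_iff₀ hXp hd]; linarith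
    calc _ = (2 * (1 + α)) * (|v - b| / X) * X ^ (-(1 + α)) := by ring
      _ ≤ 3 * (1 / d) * (h ^ 2) ^ (-(1 + α)) := by gcongr; linarith
      _ = _ := by ring
  · exact ⟨by linarith, le_refl _⟩
  · exact ⟨le_refl _, by linarith⟩

lemma aux_KtA (α a m h v : ℝ) (hα0 : 0 < α) (hh : h ≠ 0) :
    |Kt α a m h v| ≤ |h| * (h ^ 2) ^ (-(1 + α)) := by
  have hh2 : 0 < h ^ 2 := by positivity
  have e : Kt α a m h v = h * ((h ^ 2 + (v - a) ^ 2) ^ (-(1 + α))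
        - (h ^ 2 + (v - a - m) ^ 2) ^ (-(1 + α))) := by
    unfold Kt
    rw [Real.rpow_neg (by positivity), Real.rpow_neg (by positivity)]
    ring
  have h2 : ∀ y : ℝ, (h ^ 2 + y ^ 2) ^ (-(1 + α)) ≤ (h ^ 2) ^ (-(1 + α)) := by
    intro y
    apply Real.rpow_le_rpow_of_nonpos hh2 _ (by linarith)
    nlinarith [sq_nonneg y]
  have h3 : ∀ y : ℝ, 0 ≤ (h ^ 2 + y ^ 2) ^ (-(1 + α)) := fun y => by positivity
  rw [e, abs_mul]
  gcongr
  rw [abs_le]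
  constructor <;> linarith [h2 (v - a), h2 (v - a - m), h3 (v - a), h3 (v - a - m)]

/-- the dominating profile -/
def phi (α M C : ℝ) (t : ℝ) : ℝ :=
  if t ≤ M then 6 * C / M * t ^ (-(2 * α)) else 3 * C * t ^ (-1 - 2 * α)

lemma aux_Kt2 (α a m h v : ℝ) (hα0 : 0 < α) (hα : α < 1 / 2) (ha : 0 < a) (hm : 0 < m)
    (hh : h ≠ 0) (hv : |v| ≤ |h| / 2) :
    |Kt α a m h v| * |h| ≤ phi α (a + m) m |h| := by
  have hp : 0 < |h| := abs_pos.mpr hh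
  have e1 : (|h| * (h ^ 2) ^ (-(1 + α))) * |h| = |h| ^ (-(2 * α)) := by
    rw [← sq_abs h, ← Real.rpow_natCast |h| 2, ← Real.rpow_mul hp.le]
    rw [mul_comm |h|, mul_assoc, ← sq, ← Real.rpow_natCast |h| 2, ← Real.rpow_add hp]
    congr 1; push_cast; ring
  have hM : 0 < a + m := by linarith
  unfold phi
  split_ifs with hle
  · rw [← e1, ← mul_assoc]
    gcongr
    by_cases hma : a ≤ 5 * m
    · refine (aux_KtA α a m h v hα0 hh).trans ?_
      apply le_mul_of_one_le_left (by positivity)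
      rw [le_div_iff₀ hM]; linarith
    · refine (aux_Kt α a m h v ((a + m) / 2) hα0 hα hm hh (by positivity) ?_).trans
        (le_of_eq (by field_simp; norm_num))
      rintro b ⟨hb1, hb2⟩
      have : 4 * v ^ 2 ≤ h ^ 2 := by
        rw [← sq_abs v, ← sq_abs h]; nlinarith [abs_nonneg v]
      have hb3 : 5 / 6 * (a + m) ≤ b := by linarith
      nlinarith [sq_nonneg (5 * v - b)]
  · have := aux_Kt α a m h v |h| hα0 hα hm hh hp
      (fun b _ => by rw [sq_abs]; nlinarith [sq_nonneg (v - b)])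
    calc _ ≤ (3 * m / |h| * (|h| * (h ^ 2) ^ (-(1 + α)))) * |h| := by gcongr
      _ = 3 * m / |h| * |h| ^ (-(2 * α)) := by rw [mul_assoc, e1]
      _ = 3 * m * |h| ^ (-1 - 2 * α) := by
        rw [show -1 - 2 * α = -(2 * α) - 1 by ring, Real.rpow_sub_one hp.ne']; ring
      _ ≤ _ := le_refl _

lemma phi_nonneg (α M C t : ℝ) (hM : 0 < M) (hC : 0 ≤ C) (ht : 0 ≤ t) : 0 ≤ phi α M C t := by
  unfold phi; split_ifs <;> positivity

lemma phi_int (α M C : ℝ) (hα0 : 0 < α) (hα : α < 1 / 2) (hM : 0 < M) :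
    IntegrableOn (phi α M C) (Ioi 0) ∧
    ∫ t in Ioi 0, phi α M C t = (6 / (1 - 2 * α) + 3 / (2 * α)) * C / M ^ (2 * α) := by
  have c1 : EqOn (fun t : ℝ => 6 * C / M * t ^ (-(2 * α))) (phi α M C) (Ioc 0 M) := by
    intro t ht; simp [phi, ht.2]
  have c2 : EqOn (fun t : ℝ => 3 * C * t ^ (-1 - 2 * α)) (phi α M C) (Ioi M) := by
    intro t ht; simp [phi, not_le.mpr (show M < t from ht)]
  have i1 : IntegrableOn (phi α M C) (Ioc 0 M) := by
    refine IntegrableOn.congr_fun ?_ c1 measurableSet_Ioc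
    have := (intervalIntegral.intervalIntegrable_rpow' (a := 0) (b := M)
      (r := -(2 * α)) (by linarith)).const_mul (6 * C / M)
    exact (intervalIntegrable_iff_integrableOn_Ioc_of_le hM.le).1 this
  have i2 : IntegrableOn (phi α M C) (Ioi M) := by
    refine IntegrableOn.congr_fun ?_ c2 measurableSet_Ioi
    exact (integrableOn_Ioi_rpow_of_lt (by linarith) hM).const_mul _
  rw [← Ioc_union_Ioi_eq_Ioi hM.le]
  refine ⟨i1.union i2, ?_⟩
  rw [setIntegral_union (Ioc_disjoint_Ioi le_rfl) measurableSet_Ioi i1 i2,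
    ← setIntegral_congr_fun measurableSet_Ioc c1, ← setIntegral_congr_fun measurableSet_Ioi c2,
    integral_const_mul, integral_const_mul, integral_Ioi_rpow_of_lt (by linarith) hM,
    ← intervalIntegral.integral_of_le hM.le, integral_rpow (Or.inl (by linarith))]
  have z : (0 : ℝ) ^ (-(2 * α) + 1) = 0 := Real.zero_rpow (by linarith)
  rw [z, Real.rpow_add_one hM.ne', show -1 - 2 * α + 1 = -(2 * α) by ring, Real.rpow_neg hM.le]
  have : 1 - 2 * α ≠ 0 := by linarith
  have h' : -(2 * α) + 1 ≠ 0 := by linarith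
  have hMM : M ^ (2 * α) ≠ 0 := by positivity
  rw [show -(2 * α) + 1 = 1 - 2 * α by ring]
  field_simp
  ring

theorem J1_estimate (α γ B R a m s : ℝ) (hα0 : 0 < α) (hα : α < 1 / 2)
    (hγ0 : 0 < γ) (hγ1 : γ ≤ 1) (hB : 0 ≤ B) (hR : 0 < R) (ha : 0 < a) (hm : 0 < m)
    (hs : |s| ≤ B * a ^ (γ / (1 + γ))) (hs2 : |s| ≤ 1 / 2) :
    |∫ h in (-R)..R, ∫ v in (0:ℝ)..(s * h), Kt α a m h v| ≤
      (12 / (1 - 2 * α) + 3 / α) * B * a ^ (γ / (1 + γ)) * m / (a + m) ^ (2 * α) := by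
  have hM : 0 < a + m := by linarith
  obtain ⟨i, hi⟩ := phi_int α (a + m) m hα0 hα hM
  have hnn : ∀ h : ℝ, 0 ≤ phi α (a + m) m |h| :=
    fun h => phi_nonneg _ _ _ _ hM hm.le (abs_nonneg h)
  have pt : ∀ h : ℝ, ‖∫ v in (0:ℝ)..(s * h), Kt α a m h v‖ ≤ |s| * phi α (a + m) m |h| := by
    intro h
    by_cases hh : h = 0
    · subst hh
      simpa using mul_nonneg (abs_nonneg s) (hnn 0)
    have hp : 0 < |h| := abs_pos.mpr hh
    have := intervalIntegral.norm_integral_le_of_norm_le_const (a := 0) (b := s * h)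
      (f := fun v => Kt α a m h v) (C := phi α (a + m) m |h| / |h|) ?_
    · refine this.trans (le_of_eq ?_)
      rw [sub_zero, abs_mul]; field_simp
    · intro v hv
      rw [le_div_iff₀ hp, Real.norm_eq_abs]
      apply aux_Kt2 α a m h v hα0 hα ha hm hh
      have h1 : |v| ≤ |s * h| := by
        rcases mem_uIoc.1 hv with ⟨h1, h2⟩ | ⟨h1, h2⟩
        · rw [abs_of_pos h1]; exact h2.trans (le_abs_self _)
        · rw [abs_of_nonpos h2, abs_of_neg (by linarith)]; linarith
      rw [abs_mul] at h1
      nlinarith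
  have hint : Integrable (fun h : ℝ => phi α (a + m) m |h|) := by
    have hf : IntegrableOn (fun h : ℝ => phi α (a + m) m |h|) (Ioi 0) :=
      i.congr_fun (fun t ht => by rw [abs_of_pos (show (0:ℝ) < t from ht)]) measurableSet_Ioi
    have hf2 : IntegrableOn (fun h : ℝ => phi α (a + m) m |h|) (Iic 0) := by
      rw [← Measure.map_neg_eq_self (volume : Measure ℝ)]
      have me : MeasurableEmbedding fun x : ℝ => -x := (Homeomorph.neg ℝ).measurableEmbedding
      rw [me.integrableOn_map_iff]
      simp_rw [Function.comp_def, abs_neg, neg_preimage, neg_Iic, neg_zero]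
      exact Iff.mpr integrableOn_Ici_iff_integrableOn_Ioi hf
    rw [← integrableOn_univ, ← Iic_union_Ioi (a := (0:ℝ))]
    exact hf2.union hf
  have hint2 := hint.const_mul |s|
  have h1 := intervalIntegral.norm_integral_le_of_norm_le (a := -R) (b := R) (by linarith)
    (Filter.Eventually.of_forall fun h _ => pt h) hint2.intervalIntegrable
  rw [Real.norm_eq_abs] at h1
  refine h1.trans ?_
  rw [intervalIntegral.integral_of_le (by linarith)]
  refine (setIntegral_le_integral hint2 (Filter.Eventually.of_forall fun h =>
    mul_nonneg (abs_nonneg s) (hnn h))).trans ?_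
  rw [integral_const_mul, integral_comp_abs (f := phi α (a + m) m), hi]
  have hp1 : 0 < 1 - 2 * α := by linarith
  calc _ = |s| * ((12 / (1 - 2 * α) + 3 / α) * m / (a + m) ^ (2 * α)) := by
        field_simp; ring
    _ ≤ (B * a ^ (γ / (1 + γ))) * ((12 / (1 - 2 * α) + 3 / α) * m / (a + m) ^ (2 * α)) := by
        gcongr
    _ = _ := by ring

end
end

section
/- (Near-field part of Lemma 2.5) Let α ∈ (0, 1/2), a > 0, m > 0, and s ∈ ℝ with |s| ≤ 1/2. Then the iterated integral J₃ := ∫_{−(a+m)}^{a+m} ∫_{0}^{sh} [ h/(h²+(v−a)²)^{1+α} − h/(h²+(v−a−m)²)^{1+α} ] dv dh satisfies |J₃| ≤ (12/(1−2α)) · |s| · m / (a+m)^{2α}. -/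
open Real MeasureTheory Set

noncomputable section

theorem Kt_crude (α a m h v : ℝ) (hα0 : 0 < α) (hh : h ≠ 0) :
    |Kt α a m h v| ≤ |h| * (h^2) ^ (-(1+α)) := by
  have key : ∀ x : ℝ, 0 ≤ (h^2 + x^2) ^ (-(1+α)) ∧
      (h^2 + x^2) ^ (-(1+α)) ≤ (h^2) ^ (-(1+α)) := by
    intro x
    have hp : 0 < h^2 := by positivity
    refine ⟨by positivity, ?_⟩
    exact Real.rpow_le_rpow_of_nonpos hp (by nlinarith [sq_nonneg x]) (by linarith)
  have e : Kt α a m h v = h * ((h^2 + (v-a)^2) ^ (-(1+α)) - (h^2 + (v-a-m)^2) ^ (-(1+α))) := by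
    unfold Kt
    rw [Real.rpow_neg (by positivity), Real.rpow_neg (by positivity)]
    ring
  rw [e, abs_mul]
  apply mul_le_mul_of_nonneg_left _ (abs_nonneg h)
  obtain ⟨h1, h2⟩ := key (v-a)
  obtain ⟨h3, h4⟩ := key (v-a-m)
  rw [abs_le]
  constructor <;> linarith

theorem Kt_fine (α a m h v : ℝ) (hα0 : 0 < α) (hα : α < 1/2) (ha : 0 < a) (hm : 0 < m)
    (ham : 5 * (a + m) / 6 ≤ a) (hv : |v| ≤ |h| / 2) :
    |Kt α a m h v| ≤ (3/2 * (5/9 * (a+m)^2) ^ (-(1+α))) * m := by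
  have hP : ∀ t ∈ Icc (0:ℝ) m, 5/9 * (a+m)^2 ≤ h^2 + (v-a-t)^2 := by
    intro t ht
    have h1 : v^2 ≤ h^2/4 := by
      have := mul_self_le_mul_self (abs_nonneg v) hv
      have h3 := abs_mul_abs_self v
      have h4 := abs_mul_abs_self h
      nlinarith
    have h2 : 5 * (a+m)/6 ≤ a + t := by linarith [ht.1]
    have h3 : (5 * (a+m)/6)^2 ≤ (a+t)^2 := by
      apply pow_le_pow_left₀ (by positivity) h2
    nlinarith [sq_nonneg (5*v - (a+t))]
  have hb : 0 < 5/9 * (a+m)^2 := by positivity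
  have hd : ∀ t ∈ Icc (0:ℝ) m, HasDerivWithinAt (fun t => h * (h^2 + (v-a-t)^2) ^ (-(1+α)))
      (h * (-(2 * (v-a-t)) * (-(1+α)) * (h^2 + (v-a-t)^2) ^ (-(1+α) - 1))) (Icc 0 m) t := by
    intro t ht
    have h0 : HasDerivAt (fun t => h^2 + (v-a-t)^2) (-(2 * (v-a-t))) t := by
      have := (((hasDerivAt_id t).const_sub (v-a)).pow 2).const_add (h^2)
      refine this.congr_deriv ?_
      simp
    exact ((h0.rpow_const (Or.inl (by linarith [hP t ht]))).const_mul h).hasDerivWithinAt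
  have hbd : ∀ t ∈ Icc (0:ℝ) m,
      ‖h * (-(2 * (v-a-t)) * (-(1+α)) * (h^2 + (v-a-t)^2) ^ (-(1+α) - 1))‖ ≤
        3/2 * (5/9 * (a+m)^2) ^ (-(1+α)) := by
    intro t ht
    have hp : 0 < h^2 + (v-a-t)^2 := by linarith [hP t ht]
    rw [Real.rpow_sub_one hp.ne']
    set x := v - a - t
    have hm1 : (h^2 + x^2) ^ (-(1+α)) ≤ (5/9 * (a+m)^2) ^ (-(1+α)) :=
      Real.rpow_le_rpow_of_nonpos hb (hP t ht) (by linarith)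
    have hm0 : 0 ≤ (h^2 + x^2) ^ (-(1+α)) := by positivity
    have e : h * (-(2 * x) * (-(1+α)) * ((h^2 + x^2) ^ (-(1+α)) / (h^2+x^2))) =
      (2 * h * x / (h^2+x^2)) * ((1+α) * (h^2 + x^2) ^ (-(1+α))) := by ring
    rw [e, norm_mul]
    have e1 : ‖2 * h * x / (h^2+x^2)‖ ≤ 1 := by
      rw [Real.norm_eq_abs, abs_div, abs_of_pos hp, div_le_one hp, abs_le]
      constructor <;> nlinarith [sq_nonneg (h+x), sq_nonneg (h-x)]
    have e2 : ‖(1+α) * (h^2 + x^2) ^ (-(1+α))‖ ≤ 3/2 * (5/9 * (a+m)^2) ^ (-(1+α)) := by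
      rw [Real.norm_eq_abs, abs_of_nonneg (by positivity)]
      apply mul_le_mul (by linarith) hm1 hm0 (by norm_num)
    calc _ ≤ 1 * (3/2 * (5/9 * (a+m)^2) ^ (-(1+α))) :=
          mul_le_mul e1 e2 (norm_nonneg _) (by norm_num)
      _ = _ := one_mul _
  have := (convex_Icc (0:ℝ) m).norm_image_sub_le_of_norm_hasDerivWithin_le hd hbd
    (right_mem_Icc.2 hm.le) (left_mem_Icc.2 hm.le)
  have e : Kt α a m h v = h * (h^2 + (v-a-0)^2) ^ (-(1+α)) - h * (h^2 + (v-a-m)^2) ^ (-(1+α)) := by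
    unfold Kt
    rw [Real.rpow_neg (by positivity), Real.rpow_neg (by positivity), sub_zero]
    ring
  rw [e]
  simpa [abs_of_pos hm] using this

theorem uIoc_abs {v c : ℝ} (h : v ∈ uIoc (0:ℝ) c) : |v| ≤ |c| := by
  rw [mem_uIoc] at h
  rcases h with h | h
  · rw [abs_of_pos h.1, abs_of_pos (h.1.trans_le h.2)]; exact h.2
  · rw [abs_of_nonpos h.2, abs_of_neg (h.1.trans_le h.2)]; linarith [h.1]

theorem abs_int (b p : ℝ) (hb : 0 < b) (hp : -1 < p) :
    IntervalIntegrable (fun x : ℝ => |x| ^ p) volume (-b) b ∧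
    ∫ x in (-b)..b, |x| ^ p = 2 * (b ^ (p+1) / (p+1)) := by
  have i0 : IntervalIntegrable (fun x : ℝ => x ^ p) volume 0 b :=
    intervalIntegral.intervalIntegrable_rpow' hp
  have i1 : IntervalIntegrable (fun x : ℝ => |x| ^ p) volume 0 b := by
    refine i0.congr ?_
    intro x hx
    rw [uIoc_of_le hb.le] at hx
    simp [abs_of_pos hx.1]
  have i2 : IntervalIntegrable (fun x : ℝ => |x| ^ p) volume (-b) 0 := by
    have := (IntervalIntegrable.iff_comp_neg (f := fun x : ℝ => |x| ^ p) (a := 0) (b := b)).1 i1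
    simpa using this.symm
  refine ⟨i2.trans i1, ?_⟩
  have v1 : ∫ x in (0:ℝ)..b, |x| ^ p = b ^ (p+1) / (p+1) := by
    have : ∫ x in (0:ℝ)..b, |x| ^ p = ∫ x in (0:ℝ)..b, x ^ p := by
      apply intervalIntegral.integral_congr
      intro x hx
      rw [uIcc_of_le hb.le] at hx
      simp [abs_of_nonneg hx.1]
    rw [this, integral_rpow (Or.inl hp), Real.zero_rpow (by linarith), sub_zero]
  have v2 : ∫ x in (-b)..0, |x| ^ p = b ^ (p+1) / (p+1) := by
    rw [← v1]
    have := intervalIntegral.integral_comp_neg (a := 0) (b := b) (fun x : ℝ => |x| ^ p)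
    simpa using this.symm
  rw [← intervalIntegral.integral_add_adjacent_intervals i2 i1, v1, v2]
  ring

/-- (Near-field part of Lemma 2.5) For `α ∈ (0,1/2)`, `a > 0`, `m > 0`, and `|s| ≤ 1/2`,
the iterated integral `J₃ = ∫_{−(a+m)}^{a+m} ∫_{0}^{sh} K̃(h,v) dv dh` satisfies
`|J₃| ≤ (12/(1−2α)) |s| m/(a+m)^{2α}`. -/
theorem J3_estimate (α a m s : ℝ) (hα0 : 0 < α) (hα : α < 1 / 2)
    (ha : 0 < a) (hm : 0 < m) (hs : |s| ≤ 1 / 2) :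
    |∫ h in (-(a + m))..(a + m), ∫ v in (0:ℝ)..(s * h), Kt α a m h v| ≤
      12 / (1 - 2 * α) * |s| * m / (a + m) ^ (2 * α) := by
  have hb : 0 < a + m := by linarith
  have hc : 0 < 1 - 2 * α := by linarith
  rw [← Real.norm_eq_abs]
  by_cases hcase : a + m ≤ 6 * m
  · obtain ⟨hi, hv⟩ := abs_int (a+m) (-(2*α)) hb (by linarith)
    have h1 := intervalIntegral.norm_integral_le_of_norm_le (a := -(a+m)) (b := a+m) (μ := volume)
      (f := fun h => ∫ v in (0:ℝ)..(s * h), Kt α a m h v)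
      (g := fun h => |s| * |h| ^ (-(2*α))) (by linarith) (by
        have h0 : ∀ᵐ h : ℝ ∂volume, h ≠ 0 := by
          simp [ae_iff]
        filter_upwards [h0] with h hh _
        have := intervalIntegral.norm_integral_le_of_norm_le_const (a := 0) (b := s*h)
          (f := Kt α a m h) (C := |h| * (h^2) ^ (-(1+α)))
          (fun v _ => Kt_crude α a m h v hα0 hh)
        refine this.trans (le_of_eq ?_)
        have hp : 0 < |h| := abs_pos.2 hh
        have e1 : (h^2) ^ (-(1+α)) = |h| ^ (-(2*α)) / |h|^2 := by
          rw [← sq_abs h, ← Real.rpow_natCast, ← Real.rpow_mul hp.le, ← Real.rpow_sub hp]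
          congr 1
          push_cast
          ring
        rw [sub_zero, abs_mul, e1]
        field_simp) (hi.const_mul _)
    refine h1.trans ?_
    rw [intervalIntegral.integral_const_mul, hv]
    have e2 : (a+m) ^ (-(2*α)+1) = (a+m) / (a+m) ^ (2*α) := by
      rw [Real.rpow_add hb, Real.rpow_one, Real.rpow_neg hb.le]
      field_simp
    have hD : 0 < (a+m) ^ (2*α) := by positivity
    rw [e2]
    have e3 : |s| * (2 * ((a+m) / (a+m) ^ (2*α) / (-(2*α)+1))) =
      (2 * |s| / (1 - 2*α) / (a+m)^(2*α)) * (a+m) := by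
      rw [show -(2*α)+1 = 1 - 2*α by ring]; ring
    have e4 : 12 / (1 - 2 * α) * |s| * m / (a + m) ^ (2 * α) =
      (2 * |s| / (1 - 2*α) / (a+m)^(2*α)) * (6 * m) := by ring
    rw [e3, e4]
    exact mul_le_mul_of_nonneg_left hcase (by positivity)
  · push Not at hcase
    set C := (3/2 * (5/9 * (a+m)^2) ^ (-(1+α))) * m with hC
    have hC0 : 0 ≤ C := by positivity
    have h1 := intervalIntegral.norm_integral_le_of_norm_le_const (a := -(a+m)) (b := a+m)
      (f := fun h => ∫ v in (0:ℝ)..(s * h), Kt α a m h v) (C := C * (|s| * (a+m))) (by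
        intro h hh
        rw [uIoc_of_le (by linarith)] at hh
        have hh' : |h| ≤ a + m := abs_le.2 ⟨hh.1.le, hh.2⟩
        have := intervalIntegral.norm_integral_le_of_norm_le_const (a := 0) (b := s*h)
          (f := Kt α a m h) (C := C)
          (fun v hv => Kt_fine α a m h v hα0 hα ha hm (by linarith) (by
            have := uIoc_abs hv
            rw [abs_mul] at this
            nlinarith [abs_nonneg h]))
        refine this.trans ?_
        rw [sub_zero, abs_mul]
        gcongr)
    refine h1.trans ?_
    have hD : 0 < (a+m) ^ (2*α) := by positivity
    have e1 : (5/9 * (a+m)^2) ^ (-(1+α)) = (9/5) ^ (1+α) / ((a+m)^2 * (a+m)^(2*α)) := by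
      rw [Real.mul_rpow (by norm_num) (by positivity), Real.rpow_neg (by norm_num),
        ← Real.inv_rpow (by norm_num), ← Real.rpow_natCast, ← Real.rpow_mul hb.le,
        ← Real.rpow_add hb, div_eq_mul_inv (_ ^ (1+α)), ← Real.rpow_neg hb.le]
      congr 2
      · norm_num
      · push_cast; ring
    have e2 : ((9:ℝ)/5) ^ (1+α) ≤ (9/5)^2 := by
      rw [← Real.rpow_natCast]
      exact Real.rpow_le_rpow_of_exponent_le (by norm_num) (by push_cast; linarith)
    have e3 : |a + m - -(a+m)| = 2 * (a+m) := by
      rw [abs_of_pos (by linarith)]; ring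
    have e4 : C * (|s| * (a+m)) * |a + m - -(a+m)| =
        (3 * (9/5)^(1+α)) * (|s| * m / (a+m)^(2*α)) := by
      rw [e3, hC, e1]; field_simp
    have e5 : 12 / (1 - 2 * α) * |s| * m / (a + m) ^ (2 * α) =
      12 / (1 - 2*α) * (|s| * m / (a+m)^(2*α)) := by ring
    rw [e4, e5]
    apply mul_le_mul_of_nonneg_right _ (by positivity)
    rw [le_div_iff₀ hc]
    have : 0 < ((9:ℝ)/5) ^ (1+α) := by positivity
    nlinarith

end
end

section
/- (Far-field part of Lemma 2.5) Let α ∈ (0, 1/2), a > 0, m > 0, R > 0, and s ∈ ℝ with |s| ≤ 1/2. Then the integral J₄ := ∫_{{h : a+m ≤ |h| ≤ R}} ∫_{0}^{sh} [ h/(h²+(v−a)²)^{1+α} − h/(h²+(v−a−m)²)^{1+α} ] dv dh (which is zero if R < a+m) satisfies |J₄| ≤ (3/α) · |s| · m / (a+m)^{2α}. -/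
open Real MeasureTheory Set

noncomputable section

lemma Kt_aux_bound (α h : ℝ) (hα0 : 0 < α) (hh : h ≠ 0) (x y : ℝ) :
    |h / (h ^ 2 + y ^ 2) ^ (1 + α) - h / (h ^ 2 + x ^ 2) ^ (1 + α)| ≤
      (1 + α) * |h| ^ (-2 - 2 * α) * |y - x| := by
  have hpos : ∀ w : ℝ, 0 < h ^ 2 + w ^ 2 := fun w => by positivity
  have hd : ∀ w ∈ (univ : Set ℝ), HasDerivWithinAt
      (fun w : ℝ => h * (h ^ 2 + w ^ 2) ^ (-(1 + α)))
      (h * ((2 * w) * (-(1 + α)) * (h ^ 2 + w ^ 2) ^ (-(1 + α) - 1))) univ w := by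
    intro w _
    have h1 : HasDerivAt (fun w : ℝ => h ^ 2 + w ^ 2) (2 * w) w := by
      simpa using (hasDerivAt_pow 2 w).const_add (h ^ 2)
    exact ((h1.rpow_const (Or.inl (hpos w).ne')).const_mul h).hasDerivWithinAt
  have hb : ∀ w ∈ (univ : Set ℝ),
      ‖h * ((2 * w) * (-(1 + α)) * (h ^ 2 + w ^ 2) ^ (-(1 + α) - 1))‖ ≤
      (1 + α) * |h| ^ (-2 - 2 * α) := by
    intro w _
    have hp := hpos w
    have e1 : (h ^ 2 + w ^ 2) ^ (-(1 + α)) =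
        (h ^ 2 + w ^ 2) * (h ^ 2 + w ^ 2) ^ (-(1 + α) - 1) := by
      rw [rpow_sub_one hp.ne']; field_simp
    have e2 : |h| ^ (-2 - 2 * α) = (h ^ 2) ^ (-(1 + α)) := by
      rw [← sq_abs h, ← rpow_natCast, ← rpow_mul (abs_nonneg h)]
      congr 1; push_cast; ring
    have e3 : (h ^ 2 + w ^ 2) ^ (-(1 + α)) ≤ (h ^ 2) ^ (-(1 + α)) :=
      rpow_le_rpow_of_nonpos (by positivity) (by nlinarith [sq_nonneg w]) (by linarith)
    have q : 0 ≤ (h ^ 2 + w ^ 2) ^ (-(1 + α) - 1) := by positivity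
    rw [e2, Real.norm_eq_abs]
    calc _ = (1 + α) * ((2 * |h| * |w|) * (h ^ 2 + w ^ 2) ^ (-(1 + α) - 1)) := by
          simp only [abs_mul, abs_neg, abs_of_nonneg q, abs_of_pos (show 0 < 1 + α by linarith),
            abs_two]
          ring
      _ ≤ (1 + α) * ((h ^ 2 + w ^ 2) * (h ^ 2 + w ^ 2) ^ (-(1 + α) - 1)) := by
          gcongr
          nlinarith [sq_nonneg (|h| - |w|), sq_abs h, sq_abs w]
      _ ≤ _ := by rw [← e1]; gcongr
  have := Convex.norm_image_sub_le_of_norm_hasDerivWithin_le hd hb convex_univ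
    (mem_univ x) (mem_univ y)
  simpa only [rpow_neg (hpos _).le, ← div_eq_mul_inv, Real.norm_eq_abs] using this

/-- (Far-field part of Lemma 2.5) For `α ∈ (0,1/2)`, `a > 0`, `m > 0`, `R > 0`, and
`|s| ≤ 1/2`, the integral `J₄ = ∫_{a+m ≤ |h| ≤ R} ∫_{0}^{sh} K̃(h,v) dv dh` (zero if
`R < a+m`) satisfies `|J₄| ≤ (3/α) |s| m/(a+m)^{2α}`. -/
theorem J4_estimate (α a m R s : ℝ) (hα0 : 0 < α) (hα : α < 1 / 2)
    (ha : 0 < a) (hm : 0 < m) (hR : 0 < R) (hs : |s| ≤ 1 / 2) :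
    |∫ h in {h : ℝ | a + m ≤ |h| ∧ |h| ≤ R}, (∫ v in (0:ℝ)..(s * h), Kt α a m h v)| ≤
      3 / α * |s| * m / (a + m) ^ (2 * α) := by
  set c := a + m with hc
  have hc0 : 0 < c := by positivity
  set p : ℝ := -1 - 2 * α with hp
  set f : ℝ → ℝ := (Ici c).indicator (fun x => ((1 + α) * |s| * m) * x ^ p) with hf
  have hS : MeasurableSet {h : ℝ | c ≤ |h| ∧ |h| ≤ R} :=
    (measurableSet_le measurable_const measurable_norm).inter
      (measurableSet_le measurable_norm measurable_const)
  have hfi : IntegrableOn f (Ioi 0) := by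
    have h1 : IntegrableOn (fun x : ℝ => ((1 + α) * |s| * m) * x ^ p) (Ici c) := by
      rw [integrableOn_Ici_iff_integrableOn_Ioi]
      exact (integrableOn_Ioi_rpow_of_lt (by linarith) hc0).const_mul _
    exact ((integrable_indicator_iff measurableSet_Ici).2 h1).integrableOn
  have hfa : Integrable (fun x : ℝ => f |x|) := by
    have h1 : IntegrableOn (fun x : ℝ => f |x|) (Ioi 0) :=
      hfi.congr_fun (fun x hx => by simp only [abs_of_pos (mem_Ioi.1 hx)]) measurableSet_Ioi
    have h2 : IntegrableOn (fun x : ℝ => f |x|) (Iic 0) := by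
      rw [← Measure.map_neg_eq_self (volume : Measure ℝ)]
      let m : MeasurableEmbedding fun x : ℝ => -x := (Homeomorph.neg ℝ).measurableEmbedding
      rw [m.integrableOn_map_iff]
      simp_rw [Function.comp_def, abs_neg, neg_preimage, neg_Iic, neg_zero]
      exact Iff.mpr integrableOn_Ici_iff_integrableOn_Ioi h1
    rw [← integrableOn_univ, ← Iic_union_Ioi (a := (0:ℝ))]
    exact h2.union h1
  have hf0 : ∀ x, 0 ≤ f x := by
    intro x
    apply indicator_nonneg
    intro y hy
    have : 0 < y := lt_of_lt_of_le hc0 hy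
    positivity
  have hpt : ∀ h ∈ {h : ℝ | c ≤ |h| ∧ |h| ≤ R},
      ‖∫ v in (0:ℝ)..(s * h), Kt α a m h v‖ ≤ f |h| := by
    intro h hh
    have hh0 : 0 < |h| := lt_of_lt_of_le hc0 hh.1
    have := intervalIntegral.norm_integral_le_of_norm_le_const
      (a := 0) (b := s * h) (f := fun v => Kt α a m h v)
      (C := (1 + α) * |h| ^ (-2 - 2 * α) * m) (fun v _ => by
        have := Kt_aux_bound α h hα0 (abs_pos.1 hh0) (v - a - m) (v - a)
        rw [show v - a - (v - a - m) = m by ring, abs_of_pos hm] at this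
        exact this)
    refine this.trans (le_of_eq ?_)
    rw [hf, indicator_of_mem (show |h| ∈ Ici c from hh.1), sub_zero, abs_mul,
      show p = (-2 - 2 * α) + 1 by rw [hp]; ring, rpow_add_one hh0.ne']
    ring
  have hint : ∫ x, f |x| = 2 * (((1 + α) * |s| * m) * (c ^ (-(2 * α)) / (2 * α))) := by
    rw [integral_comp_abs, hf, setIntegral_indicator measurableSet_Ici,
      inter_eq_self_of_subset_right (Ici_subset_Ioi.2 hc0), integral_Ici_eq_integral_Ioi,
      integral_const_mul, integral_Ioi_rpow_of_lt (by linarith) hc0,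
      show p + 1 = -(2 * α) by rw [hp]; ring, neg_div_neg_eq]
  calc _ ≤ ∫ h in {h : ℝ | c ≤ |h| ∧ |h| ≤ R}, f |h| :=
        norm_integral_le_of_norm_le hfa.integrableOn ((ae_restrict_iff' hS).2 (ae_of_all _ hpt))
    _ ≤ ∫ h, f |h| := setIntegral_le_integral hfa (ae_of_all _ fun x => hf0 _)
    _ = (1 + α) * (1 / α * |s| * m / c ^ (2 * α)) := by
        rw [hint, rpow_neg hc0.le]; field_simp
    _ ≤ 3 * (1 / α * |s| * m / c ^ (2 * α)) := by
        gcongr; linarith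
    _ = _ := by ring

end
end

section
/- (Pointwise kernel estimate I) Let α ∈ (0, 1/2], m ≥ 0, h ∈ ℝ with h ≠ 0, and v ∈ ℝ such that (h,v) ∉ {(0,0),(0,m)}. Then | h/(h²+v²)^{1+α} − h/(h²+(v−m)²)^{1+α} | ≤ 3 m / |h|^{2+2α}. -/
open Real

noncomputable section

/-- (Pointwise kernel estimate I) For `α ∈ (0,1/2]`, `m ≥ 0` and `h ≠ 0`,
`|K_m(h,v)| ≤ 3m/|h|^{2+2α}`. -/
theorem pointwise_kernel_estimate_I (α m h v : ℝ) (hα0 : 0 < α) (hα : α ≤ 1 / 2)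
    (hm : 0 ≤ m) (hh : h ≠ 0) :
    |Km α m h v| ≤ 3 * m / |h| ^ (2 + 2 * α) := by
  have hpos : ∀ x : ℝ, 0 < h ^ 2 + x ^ 2 := fun x => by positivity
  have hder : ∀ x : ℝ, HasDerivAt (fun x : ℝ => h * (h ^ 2 + x ^ 2) ^ (-(1 + α)))
      (h * ((2 * x) * (-(1 + α)) * (h ^ 2 + x ^ 2) ^ (-(1 + α) - 1))) x := by
    intro x
    have h1 : HasDerivAt (fun x : ℝ => h ^ 2 + x ^ 2) (2 * x) x := by
      simpa using (hasDerivAt_pow 2 x).const_add (h ^ 2)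
    exact (h1.rpow_const (Or.inl (hpos x).ne')).const_mul h
  have hC : (h ^ 2) ^ (-(1 + α)) = (|h| ^ (2 + 2 * α))⁻¹ := by
    rw [← sq_abs, ← Real.rpow_natCast, ← Real.rpow_mul (abs_nonneg h),
      ← Real.rpow_neg (abs_nonneg h)]
    congr 1
    push_cast
    ring
  have hbd : ∀ x : ℝ, ‖h * ((2 * x) * (-(1 + α)) * (h ^ 2 + x ^ 2) ^ (-(1 + α) - 1))‖
      ≤ 3 * (|h| ^ (2 + 2 * α))⁻¹ := by
    intro x
    have hp := hpos x
    have e1 : (h ^ 2 + x ^ 2) ^ (-(1 + α) - 1) = (h ^ 2 + x ^ 2) ^ (-(1 + α)) / (h ^ 2 + x ^ 2) :=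
      Real.rpow_sub_one hp.ne' _
    have e2 : (h ^ 2 + x ^ 2) ^ (-(1 + α)) ≤ (h ^ 2) ^ (-(1 + α)) :=
      Real.rpow_le_rpow_of_nonpos (by positivity) (by nlinarith [sq_nonneg x]) (by linarith)
    have e0 : 0 < (h ^ 2 + x ^ 2) ^ (-(1 + α)) := Real.rpow_pos_of_pos hp _
    rw [hC] at e2
    rw [e1]
    have e3 : h * (2 * x * (-(1 + α)) * ((h ^ 2 + x ^ 2) ^ (-(1 + α)) / (h ^ 2 + x ^ 2)))
        = (-(1 + α)) * ((2 * h * x) / (h ^ 2 + x ^ 2)) * (h ^ 2 + x ^ 2) ^ (-(1 + α)) := by ring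
    have e4 : |(2 * h * x) / (h ^ 2 + x ^ 2)| ≤ 1 := by
      rw [abs_div, abs_of_pos hp, div_le_one hp, abs_le]
      constructor <;> nlinarith [sq_nonneg (h + x), sq_nonneg (h - x)]
    rw [e3, Real.norm_eq_abs, abs_mul, abs_mul, abs_of_pos e0, abs_neg,
      abs_of_pos (by linarith : 0 < 1 + α)]
    have e5 : (1 + α) * |(2 * h * x) / (h ^ 2 + x ^ 2)| ≤ 3 := by
      nlinarith [abs_nonneg ((2 * h * x) / (h ^ 2 + x ^ 2))]
    exact mul_le_mul e5 e2 e0.le (by norm_num)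
  have key := Convex.norm_image_sub_le_of_norm_hasDerivWithin_le (s := Set.univ)
    (fun x _ => (hder x).hasDerivWithinAt) (fun x _ => hbd x) convex_univ
    (Set.mem_univ (v - m)) (Set.mem_univ v)
  simp only [Real.norm_eq_abs] at key
  have e6 : v - (v - m) = m := by ring
  rw [e6, abs_of_nonneg hm, Real.rpow_neg (hpos _).le, Real.rpow_neg (hpos _).le] at key
  unfold Km
  rw [div_eq_mul_inv, div_eq_mul_inv, div_eq_mul_inv]
  calc _ ≤ _ := key
    _ = _ := by ring

end
end

section
/- (Pointwise kernel estimate II) Let α ∈ (0, 1/2], m ≥ 0, h ≠ 0, and v ∈ ℝ, and set V := max(|v|, |v−m|). If V ≥ |h| and V > 0, then | h/(h²+v²)^{1+α} − h/(h²+(v−m)²)^{1+α} | ≤ 6 m / (|h|^{1+2α} V). -/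
open Real

noncomputable section

theorem km_aux (α a w V m : ℝ) (hα0 : 0 < α) (hα : α ≤ 1 / 2) (ha : 0 < a) (hw : 0 ≤ w)
    (hwV : w ≤ V) (hV : 0 < V) (hm : V - w ≤ m) :
    |a / (a ^ 2 + w ^ 2) ^ (1 + α) - a / (a ^ 2 + V ^ 2) ^ (1 + α)|
      ≤ 6 * m / (a ^ (1 + 2 * α) * V) := by
  have hp : 0 < a ^ 2 + w ^ 2 := by positivity
  have hq : 0 < a ^ 2 + V ^ 2 := by positivity
  have hpq : a ^ 2 + w ^ 2 ≤ a ^ 2 + V ^ 2 := by gcongr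
  have hm0 : 0 ≤ m := by linarith
  have hX : 0 < (a ^ 2 + w ^ 2) ^ (1 + α) := Real.rpow_pos_of_pos hp _
  have hXY : (a ^ 2 + w ^ 2) ^ (1 + α) ≤ (a ^ 2 + V ^ 2) ^ (1 + α) :=
    Real.rpow_le_rpow hp.le hpq (by linarith)
  have hZ : a ^ (1 + 2 * α) * a ≤ (a ^ 2 + w ^ 2) ^ (1 + α) := by
    have h1 : a ^ (1 + 2 * α) * a = (a ^ 2) ^ (1 + α) := by
      rw [← Real.rpow_natCast a 2, ← Real.rpow_mul ha.le, ← Real.rpow_add_one ha.ne']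
      congr 1
      push_cast
      ring
    rw [h1]
    exact Real.rpow_le_rpow (by positivity) (by nlinarith [sq_nonneg w]) (by linarith)
  have hB := one_add_mul_self_le_rpow_one_add
    (s := (a ^ 2 + w ^ 2) / (a ^ 2 + V ^ 2) - 1) (by
      have : 0 < (a ^ 2 + w ^ 2) / (a ^ 2 + V ^ 2) := by positivity
      linarith) (p := 1 + α) (by linarith)
  rw [add_sub_cancel, Real.div_rpow hp.le hq.le] at hB
  have hD : 1 - (a ^ 2 + w ^ 2) / (a ^ 2 + V ^ 2) ≤ 2 * m / V := by
    rw [one_sub_div hq.ne', div_le_div_iff₀ hq hV]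
    have h2 : (V - w) * (V + w) ≤ m * (2 * V) := by
      apply mul_le_mul hm (by linarith) (by linarith) hm0
    have h3 : 0 ≤ m * a ^ 2 := by positivity
    nlinarith [mul_le_mul_of_nonneg_right h2 hV.le]
  have hD0 : 0 ≤ 2 * m / V := by positivity
  generalize (a ^ 2 + w ^ 2) ^ (1 + α) = X at *
  generalize (a ^ 2 + V ^ 2) ^ (1 + α) = Y at *
  have hY : 0 < Y := by linarith
  have hE : 1 - X / Y ≤ 3 * (m / V) := by
    have h5 : 2 * m / V = 2 * (m / V) := by ring
    nlinarith
  have hZp : 0 < a ^ (1 + 2 * α) := Real.rpow_pos_of_pos ha _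
  rw [abs_of_nonneg (sub_nonneg.2 (by gcongr))]
  have hmV : 0 ≤ m / V := by positivity
  calc a / X - a / Y = a / X * (1 - X / Y) := by field_simp
    _ ≤ a / X * (3 * (m / V)) := by gcongr
    _ ≤ 1 / a ^ (1 + 2 * α) * (3 * (m / V)) := by
      gcongr ?_ * _
      rw [div_le_div_iff₀ hX hZp]
      linarith
    _ ≤ 1 / a ^ (1 + 2 * α) * (6 * (m / V)) := by gcongr; norm_num
    _ = _ := by field_simp

/-- (Pointwise kernel estimate II) For `α ∈ (0,1/2]`, `m ≥ 0`, `h ≠ 0` and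
`V := max(|v|,|v−m|)` with `V ≥ |h|` and `V > 0`, one has `|K_m(h,v)| ≤ 6m/(|h|^{1+2α} V)`. -/
theorem pointwise_kernel_estimate_II (α m h v : ℝ) (hα0 : 0 < α) (hα : α ≤ 1 / 2)
    (hm : 0 ≤ m) (hh : h ≠ 0)
    (hV : |h| ≤ max |v| |v - m|) (hV0 : 0 < max |v| |v - m|) :
    |Km α m h v| ≤ 6 * m / (|h| ^ (1 + 2 * α) * max |v| |v - m|) := by
  have ha : 0 < |h| := abs_pos.2 hh
  have key : |Km α m h v| = |(|h| / (|h| ^ 2 + |v| ^ 2) ^ (1 + α)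
      - |h| / (|h| ^ 2 + |v - m| ^ 2) ^ (1 + α))| := by
    unfold Km
    simp only [sq_abs]
    rw [div_eq_mul_inv, div_eq_mul_inv, div_eq_mul_inv, div_eq_mul_inv, ← mul_sub, ← mul_sub,
      abs_mul, abs_mul, abs_abs]
  rw [key]
  have hd : |(|v| - |v - m|)| ≤ m := by
    have := abs_abs_sub_abs_le v (v - m)
    rwa [sub_sub_cancel, abs_of_nonneg hm] at this
  rw [abs_le] at hd
  rcases le_total |v| |v - m| with hc | hc
  · rw [max_eq_right hc] at *
    exact km_aux α _ _ _ m hα0 hα ha (abs_nonneg _) hc hV0 (by linarith)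
  · rw [max_eq_left hc] at *
    rw [abs_sub_comm]
    exact km_aux α _ _ _ m hα0 hα ha (abs_nonneg _) hc hV0 (by linarith)

end
end

section
/- (Pointwise shifted kernel estimate) Let α ∈ (0, 1/2], a > 0, m ≥ 0, and let h, v ∈ ℝ satisfy h ≠ 0, |h| ≤ a+m, and |v| ≤ (a+m)/2. Then v − a − m ≤ −(a+m)/2, |v − a| ≤ |v − a − m|, and | h/(h²+(v−a)²)^{1+α} − h/(h²+(v−a−m)²)^{1+α} | ≤ 6 m / ( |h|^{1+2α} (a+m) ). -/
open Real

noncomputable section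

/-- (Pointwise shifted kernel estimate) For `α ∈ (0,1/2]`, `a > 0`, `m ≥ 0`, `h ≠ 0` with
`|h| ≤ a+m` and `|v| ≤ (a+m)/2`, one has `v−a−m ≤ −(a+m)/2`, `|v−a| ≤ |v−a−m|`, and
`|K̃(h,v)| ≤ 6m/(|h|^{1+2α}(a+m))`. -/
theorem pointwise_shifted_kernel_estimate (α a m h v : ℝ) (hα0 : 0 < α) (hα : α ≤ 1 / 2)
    (ha : 0 < a) (hm : 0 ≤ m) (hh : h ≠ 0) (hha : |h| ≤ a + m) (hv : |v| ≤ (a + m) / 2) :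
    v - a - m ≤ -((a + m) / 2) ∧ |v - a| ≤ |v - a - m| ∧
      |Kt α a m h v| ≤ 6 * m / (|h| ^ (1 + 2 * α) * (a + m)) := by
  obtain ⟨hv1, hv2⟩ := abs_le.mp hv
  have hL : 0 < a + m := by linarith
  have h1 : v - a - m ≤ -((a + m) / 2) := by linarith
  have h2 : |v - a| ≤ |v - a - m| := by
    rw [abs_of_nonpos (by linarith : v - a - m ≤ 0)]
    exact abs_le.mpr ⟨by linarith, by linarith⟩
  refine ⟨h1, h2, ?_⟩
  have hsq : (v - a) ^ 2 ≤ (v - a - m) ^ 2 := sq_le_sq.mpr h2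
  have hH : 0 < |h| := abs_pos.mpr hh
  have hh2 : 0 < h ^ 2 := by positivity
  unfold Kt
  have hmid : (h ^ 2 + (v - a - m) ^ 2) - (h ^ 2 + (v - a) ^ 2) = m * (2 * (a + m - v) - m) := by
    ring
  have hBw : (a + m - v) ^ 2 ≤ h ^ 2 + (v - a - m) ^ 2 := by nlinarith
  have hAh : h ^ 2 ≤ h ^ 2 + (v - a) ^ 2 := by nlinarith [sq_nonneg (v - a)]
  have hAB : h ^ 2 + (v - a) ^ 2 ≤ h ^ 2 + (v - a - m) ^ 2 := by linarith
  generalize h ^ 2 + (v - a) ^ 2 = A at *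
  generalize h ^ 2 + (v - a - m) ^ 2 = B at *
  have hA : 0 < A := by linarith
  have hB : 0 < B := by linarith
  have hX : 0 < A ^ (1 + α) := rpow_pos_of_pos hA _
  have hY : 0 < B ^ (1 + α) := rpow_pos_of_pos hB _
  have hQ : 0 < |h| ^ (1 + 2 * α) := rpow_pos_of_pos hH _
  have hXQ : |h| * |h| ^ (1 + 2 * α) ≤ A ^ (1 + α) := by
    calc |h| * |h| ^ (1 + 2 * α) = |h| ^ (1 + (1 + 2 * α)) := by
          rw [rpow_add hH 1 (1 + 2 * α), rpow_one]
      _ = (h ^ 2) ^ (1 + α) := by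
          rw [← sq_abs, ← rpow_natCast, ← rpow_mul hH.le]
          congr 1
          push_cast
          ring
      _ ≤ A ^ (1 + α) := rpow_le_rpow hh2.le hAh (by linarith)
  have hbern : 1 + (1 + α) * (A / B - 1) ≤ A ^ (1 + α) / B ^ (1 + α) := by
    have := one_add_mul_self_le_rpow_one_add (s := A / B - 1) (p := 1 + α)
      (by have : 0 < A / B := by positivity
          linarith) (by linarith)
    rwa [add_sub_cancel, div_rpow hA.le hB.le] at this
  have hXY : A ^ (1 + α) ≤ B ^ (1 + α) := rpow_le_rpow hA.le hAB (by linarith)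
  generalize A ^ (1 + α) = X at *
  generalize B ^ (1 + α) = Y at *
  generalize |h| ^ (1 + 2 * α) = Q at *
  have hfrac : 1 - A / B ≤ 4 * m / (a + m) := by
    have : 1 - A / B = (B - A) / B := by field_simp
    rw [this, hmid, div_le_div_iff₀ hB hL]
    have hw : (2 * (a + m - v) - m) * (a + m) ≤ 4 * B := by nlinarith
    nlinarith [mul_le_mul_of_nonneg_left hw hm]
  have hfrac0 : 0 ≤ 4 * m / (a + m) := by positivity
  have hone : 1 - X / Y ≤ 6 * m / (a + m) := by
    have e : 6 * m / (a + m) = (3 / 2) * (4 * m / (a + m)) := by ring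
    rw [e]
    nlinarith
  have hone0 : 0 ≤ 1 - X / Y := by
    have := (div_le_one hY).mpr hXY
    linarith
  have e1 : h / X - h / Y = h * (1 / X * (1 - X / Y)) := by field_simp
  rw [e1, abs_mul, abs_of_nonneg (a := 1 / X * (1 - X / Y)) (by positivity), ← mul_assoc]
  have hq : |h| * (1 / X) ≤ 1 / Q := by
    rw [mul_one_div, div_le_div_iff₀ hX hQ]
    linarith
  calc |h| * (1 / X) * (1 - X / Y) ≤ 1 / Q * (6 * m / (a + m)) := by gcongr
    _ = 6 * m / (Q * (a + m)) := by field_simp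

end
end
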